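/- Generator convergence in the critical case α = 2 (from Subsection 1.2): for every integer d ≥ 1, every compactly supported smooth function f : R^d → R and every u ∈ R^d, lim_{N→+∞} N · Σ_{y ∈ Z^d, y ≠ 0} ‖y‖₂^{−(d+2)} · ( f(u + y/√(N log N)) − f(u) ) = (1/2) · Σ_{i,j=1}^{d} K^{i,j} · ∂² f/∂u_i ∂u_j (u), where the limit is taken as the real parameter N tends to +∞ over N > 1. -/

import Mathlib

open MeasureTheory Filter Topology

/-- Euclidean (l²) norm of a vector in `Fin d → ℝ`. -/
noncomputable def l2norm {d : ℕ} (u : Fin d → ℝ) : ℝ := Real.sqrt (∑ i, u i ^ 2)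

/-- Euclidean norm of a lattice point. -/
noncomputable def zl2 {d : ℕ} (y : Fin d → ℤ) : ℝ := l2norm (fun i => (y i : ℝ))

/-- The constant `K^{i,j} = (1/2) ∫_{S^{d−1}} v_i v_j dσ(v)`, where `σ` is the surface
measure on the unit sphere of `R^d`. -/
noncomputable def Kconst (d : ℕ) (i j : Fin d) : ℝ :=
  (1 / 2 : ℝ) * ∫ v : Metric.sphere (0 : EuclideanSpace ℝ (Fin d)) 1,
    ((v : EuclideanSpace ℝ (Fin d)) i * (v : EuclideanSpace ℝ (Fin d)) j)
      ∂((volume : Measure (EuclideanSpace ℝ (Fin d))).toSphere)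

/-- Abel summation over an interval of natural numbers. -/
theorem sum_Ico_sub_mul_eq (A b : ℕ → ℝ) {m n : ℕ} (hmn : m ≤ n) :
    ∑ k ∈ Finset.Ico m n, (A (k + 1) - A k) * b k =
      A n * b n - A m * b m + ∑ k ∈ Finset.Ico m n, A (k + 1) * (b k - b (k + 1)) := by
  induction n, hmn using Nat.le_induction with
  | base => simp
  | succ n hmn ih =>
    rw [Finset.sum_Ico_succ_top hmn, Finset.sum_Ico_succ_top hmn, ih]
    ring

theorem rpow_neg_sub_rpow_neg_succ_le {p x : ℝ} (hp : 0 ≤ p) (hx : 0 < x) :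
    x ^ (-p) - (x + 1) ^ (-p) ≤ p * x ^ (-p - 1) := by
  have h1 : 1 - p / x ≤ (1 + 1 / x) ^ (-p) := by
    rw [Real.rpow_def_of_pos (by positivity)]
    have h2 : Real.log (1 + 1 / x) ≤ 1 / x := by
      have := Real.log_le_sub_one_of_pos (show 0 < 1 + 1 / x by positivity)
      linarith
    have h3 := Real.add_one_le_exp (Real.log (1 + 1 / x) * -p)
    have h4 : Real.log (1 + 1 / x) * p ≤ 1 / x * p := by gcongr
    have h5 : p / x = 1 / x * p := by ring
    linarith
  have h2 : (x + 1) ^ (-p) = x ^ (-p) * (1 + 1 / x) ^ (-p) := by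
    rw [← Real.mul_rpow hx.le (by positivity)]
    congr 1
    field_simp
  have h3 : x ^ (-p - 1) = x ^ (-p) / x := Real.rpow_sub_one hx.ne' _
  have h4 : 0 < x ^ (-p) := Real.rpow_pos_of_pos hx _
  rw [h2, h3]
  calc x ^ (-p) - x ^ (-p) * (1 + 1 / x) ^ (-p) = x ^ (-p) * (1 - (1 + 1 / x) ^ (-p)) := by ring
    _ ≤ x ^ (-p) * (p / x) := by gcongr; linarith
    _ = _ := by ring

theorem tendsto_mul_rpow_neg_sub_rpow_neg_succ (s : ℝ) :
    Tendsto (fun x : ℝ => x * (1 - (1 + 1 / x) ^ (-s))) atTop (𝓝 s) := by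
  have h : HasDerivAt (fun t : ℝ => (1 + t) ^ (-s)) (-s) 0 := by
    have h1 : HasDerivAt (fun t : ℝ => 1 + t) 1 0 := by
      simpa using (hasDerivAt_id (0 : ℝ)).const_add 1
    simpa using h1.rpow_const (p := -s) (Or.inl (by norm_num))
  have h2 := (hasDerivAt_iff_tendsto_slope.1 h).comp
    ((tendsto_inv_atTop_nhdsGT_zero (𝕜 := ℝ)).mono_right
      (nhdsWithin_mono _ (fun x hx => ne_of_gt hx)))
  have h3 := h2.neg
  rw [neg_neg] at h3
  refine h3.congr fun x => ?_
  simp [slope_def_field]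
  ring

theorem tendsto_harmonic_div_log :
    Tendsto (fun n : ℕ => (∑ k ∈ Finset.range n, 1 / ((k : ℝ) + 1)) / Real.log n) atTop (𝓝 1) := by
  have hl : Tendsto (fun n : ℕ => Real.log n) atTop atTop :=
    Real.tendsto_log_atTop.comp tendsto_natCast_atTop_atTop
  have h1 := Real.tendsto_harmonic_sub_log.div_atTop hl
  have h2 := h1.add_const 1
  rw [zero_add] at h2
  refine h2.congr' ?_
  filter_upwards [hl.eventually_gt_atTop 0] with n hn
  have : (harmonic n : ℝ) = ∑ k ∈ Finset.range n, 1 / ((k : ℝ) + 1) := by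
    simp [harmonic]
  rw [this]
  field_simp
  ring

/-- If a counting function `A` satisfies `A n ~ V n ^ s`, then
`∑_{k ≤ n} (A k - A (k - 1)) k ^ (-s) ~ s V log n`. -/
theorem tendsto_sum_sub_mul_rpow_div_log {A : ℕ → ℝ} {s V : ℝ}
    (hA : Tendsto (fun n : ℕ => A n * (n : ℝ) ^ (-s)) atTop (𝓝 V)) :
    Tendsto (fun n : ℕ => (∑ k ∈ Finset.range n, (A (k + 1) - A k) * ((k : ℝ) + 1) ^ (-s)) /
      Real.log n) atTop (𝓝 (s * V)) := by
  have hl : Tendsto (fun n : ℕ => Real.log n) atTop atTop :=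
    Real.tendsto_log_atTop.comp tendsto_natCast_atTop_atTop
  have hA1 : Tendsto (fun n : ℕ => A (n + 1) * ((n : ℝ) + 1) ^ (-s)) atTop (𝓝 V) := by
    simpa [Function.comp_def] using hA.comp (tendsto_add_atTop_nat 1)
  have hcast : Tendsto (fun n : ℕ => (n : ℝ) + 1) atTop atTop :=
    tendsto_atTop_add_const_right _ _ tendsto_natCast_atTop_atTop
  have hratio := (tendsto_mul_rpow_neg_sub_rpow_neg_succ s).comp hcast
  set x : ℕ → ℝ := fun k => A (k + 1) * (((k : ℝ) + 1) ^ (-s) - ((k : ℝ) + 1 + 1) ^ (-s)) with hx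
  have hxlim : Tendsto (fun k : ℕ => x k * ((k : ℝ) + 1)) atTop (𝓝 (s * V)) := by
    have := hratio.mul hA1
    refine this.congr fun k => ?_
    have hk : (0 : ℝ) < (k : ℝ) + 1 := by positivity
    have h2 : ((k : ℝ) + 1 + 1) ^ (-s) = ((k : ℝ) + 1) ^ (-s) * (1 + 1 / ((k : ℝ) + 1)) ^ (-s) := by
      rw [← Real.mul_rpow hk.le (by positivity)]
      congr 1
      field_simp
    simp only [hx, Function.comp, h2]
    ring
  have hlo : (fun k => x k - s * V * (1 / ((k : ℝ) + 1))) =o[atTop]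
      fun k : ℕ => 1 / ((k : ℝ) + 1) := by
    rw [Asymptotics.isLittleO_iff_tendsto' (Eventually.of_forall fun k hk => by
      have : (0 : ℝ) < 1 / ((k : ℝ) + 1) := by positivity
      exact absurd hk this.ne')]
    have := hxlim.sub_const (s * V)
    rw [sub_self] at this
    refine this.congr fun k => ?_
    have hk : (0 : ℝ) < (k : ℝ) + 1 := by positivity
    field_simp
  have hdiv : Tendsto (fun n : ℕ => ∑ k ∈ Finset.range n, 1 / ((k : ℝ) + 1)) atTop atTop :=
    Real.tendsto_sum_range_one_div_nat_succ_atTop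
  have hsum := hlo.sum_range (fun k => by positivity) hdiv
  have hsum' : Tendsto (fun n : ℕ => (∑ k ∈ Finset.range n, x k) / Real.log n) atTop
      (𝓝 (s * V)) := by
    have h1 := hsum.tendsto_div_nhds_zero.mul tendsto_harmonic_div_log
    have h2 := h1.add (tendsto_harmonic_div_log.const_mul (s * V))
    rw [zero_mul, zero_add, mul_one] at h2
    refine h2.congr' ?_
    filter_upwards [hl.eventually_gt_atTop 0, hdiv.eventually_gt_atTop 0] with n hn hn'
    rw [Finset.sum_sub_distrib, ← Finset.mul_sum]
    field_simp
    ring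
  have hb : Tendsto (fun n : ℕ => A n * ((n : ℝ) + 1) ^ (-s)) atTop (𝓝 V) := by
    have h1 : Tendsto (fun n : ℕ => (1 + 1 / (n : ℝ)) ^ (-s)) atTop (𝓝 1) := by
      have h0 : Tendsto (fun n : ℕ => 1 + 1 / (n : ℝ)) atTop (𝓝 1) := by
        simpa using tendsto_one_div_atTop_nhds_zero_nat.const_add (1 : ℝ)
      simpa using h0.rpow_const (p := -s) (Or.inl one_ne_zero)
    have := hA.mul h1
    rw [mul_one] at this
    refine this.congr' ?_
    filter_upwards [eventually_gt_atTop 0] with n hn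
    have hn' : (0 : ℝ) < n := by exact_mod_cast hn
    rw [mul_assoc, ← Real.mul_rpow hn'.le (by positivity)]
    congr 2
    field_simp
  have hend := ((hb.sub_const (A 0)).div_atTop hl).add hsum'
  rw [zero_add] at hend
  refine hend.congr fun n => ?_
  have := sum_Ico_sub_mul_eq A (fun k => ((k : ℝ) + 1) ^ (-s)) (Nat.zero_le n)
  rw [← Finset.range_eq_Ico] at this
  rw [this, add_div]
  simp [hx]

/-- Tail bound for a counting function of order at most `n ^ s`. -/
theorem sum_Ico_sub_mul_rpow_le {A : ℕ → ℝ} {s C : ℝ} (hs : 0 ≤ s) (hA0 : ∀ n, 0 ≤ A n)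
    (hA : ∀ n : ℕ, 1 ≤ n → A n ≤ C * (n : ℝ) ^ s) {m n : ℕ} (hm : 1 ≤ m) (hmn : m ≤ n) :
    ∑ k ∈ Finset.Ico m n, (A (k + 1) - A k) * ((k : ℝ) + 1) ^ (-(s + 1)) ≤ C * (s + 2) / m := by
  have hC : 0 ≤ C := by simpa using (hA0 1).trans (hA 1 le_rfl)
  have hm0 : (0 : ℝ) < m := by exact_mod_cast hm
  have hn0 : (0 : ℝ) < n := by exact_mod_cast hm.trans hmn
  have hmn' : (m : ℝ) ≤ n := by exact_mod_cast hmn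
  have hterm : ∀ k ∈ Finset.Ico m n,
      A (k + 1) * (((k : ℝ) + 1) ^ (-(s + 1)) - ((k : ℝ) + 1 + 1) ^ (-(s + 1))) ≤
        C * (s + 1) * (1 / (k : ℝ) - 1 / ((k : ℝ) + 1)) := by
    intro k hk
    have hk0 : (0 : ℝ) < k := by exact_mod_cast hm.trans (Finset.mem_Ico.1 hk).1
    have hk1 : (0 : ℝ) < (k : ℝ) + 1 := by positivity
    have h1 : A (k + 1) ≤ C * ((k : ℝ) + 1) ^ s := by simpa using hA (k + 1) (by omega)
    have h2 := rpow_neg_sub_rpow_neg_succ_le (p := s + 1) (by linarith) hk1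
    calc _ ≤ A (k + 1) * ((s + 1) * ((k : ℝ) + 1) ^ (-(s + 1) - 1)) := by
          gcongr; exact hA0 _
      _ ≤ C * ((k : ℝ) + 1) ^ s * ((s + 1) * ((k : ℝ) + 1) ^ (-(s + 1) - 1)) := by gcongr
      _ = C * (s + 1) * (((k : ℝ) + 1) ^ s * ((k : ℝ) + 1) ^ (-(s + 1) - 1)) := by ring
      _ = C * (s + 1) * (1 / ((k : ℝ) + 1) ^ 2) := by
          rw [← Real.rpow_add hk1, show s + (-(s + 1) - 1) = -(2 : ℕ) by push_cast; ring,
            Real.rpow_neg hk1.le, Real.rpow_natCast, one_div]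
      _ ≤ _ := by
          gcongr
          rw [div_sub_div _ _ hk0.ne' hk1.ne', div_le_div_iff₀ (by positivity) (by positivity)]
          nlinarith
  have htel : ∑ k ∈ Finset.Ico m n, (1 / (k : ℝ) - 1 / ((k : ℝ) + 1)) = 1 / m - 1 / n := by
    have := Finset.sum_Ico_sub (fun k : ℕ => -(1 / (k : ℝ))) hmn
    push_cast at this
    rw [show (1 : ℝ) / m - 1 / n = -(1 / n) - -(1 / m) by ring, ← this]
    exact Finset.sum_congr rfl fun k _ => by ring
  have hAn : A n * ((n : ℝ) + 1) ^ (-(s + 1)) ≤ C / m := by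
    calc _ ≤ C * (n : ℝ) ^ s * (n : ℝ) ^ (-(s + 1)) := by
          gcongr ?_ * ?_
          · exact hA n (hm.trans hmn)
          · exact Real.rpow_le_rpow_of_nonpos hn0 (by linarith) (by linarith)
      _ = C / n := by
          rw [mul_assoc, ← Real.rpow_add hn0, show s + -(s + 1) = -1 by ring, Real.rpow_neg_one,
            div_eq_mul_inv]
      _ ≤ C / m := by gcongr
  rw [sum_Ico_sub_mul_eq A (fun k => ((k : ℝ) + 1) ^ (-(s + 1))) hmn]
  have hAm : 0 ≤ A m * ((m : ℝ) + 1) ^ (-(s + 1)) := mul_nonneg (hA0 m) (by positivity)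
  have hS : ∑ k ∈ Finset.Ico m n,
      A (k + 1) * (((k : ℝ) + 1) ^ (-(s + 1)) - ((k : ℝ) + 1 + 1) ^ (-(s + 1))) ≤
        C * (s + 1) * (1 / m) := by
    refine (Finset.sum_le_sum hterm).trans ?_
    rw [← Finset.mul_sum, htel]
    gcongr
    linarith [show (0 : ℝ) ≤ 1 / n by positivity]
  push_cast
  calc _ ≤ C / m + C * (s + 1) * (1 / m) := by linarith
    _ = _ := by ring

/-- The squared Euclidean norm of a lattice point, as a natural number. -/
def sqNorm {d : ℕ} (y : Fin d → ℤ) : ℕ := ∑ i, (y i).natAbs ^ 2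

theorem cast_sqNorm {d : ℕ} (y : Fin d → ℤ) : (sqNorm y : ℝ) = ∑ i, (y i : ℝ) ^ 2 := by
  simp [sqNorm, Nat.cast_natAbs]

theorem sqNorm_eq_zero {d : ℕ} {y : Fin d → ℤ} : sqNorm y = 0 ↔ y = 0 := by
  simp [sqNorm, funext_iff]

theorem finite_sqNorm_le (d n : ℕ) : {y : Fin d → ℤ | sqNorm y ≤ n}.Finite := by
  refine (Set.finite_Icc (fun _ : Fin d => -(n : ℤ)) (fun _ => (n : ℤ))).subset fun y hy => ?_
  have h : ∀ i, (y i).natAbs ≤ n := fun i =>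
    (Nat.le_self_pow two_ne_zero _).trans
      ((Finset.single_le_sum (f := fun i => (y i).natAbs ^ 2) (fun _ _ => Nat.zero_le _)
        (Finset.mem_univ i)).trans hy)
  exact ⟨fun i => by have := h i; simp only; omega, fun i => by have := h i; simp only; omega⟩

/-- The lattice points of squared Euclidean norm at most `n`. -/
noncomputable def latticeBall (d n : ℕ) : Finset (Fin d → ℤ) := (finite_sqNorm_le d n).toFinset

theorem mem_latticeBall {d n : ℕ} {y : Fin d → ℤ} : y ∈ latticeBall d n ↔ sqNorm y ≤ n := by
  simp [latticeBall]

theorem latticeBall_mono {d m n : ℕ} (h : m ≤ n) : latticeBall d m ⊆ latticeBall d n :=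
  fun _ hy => mem_latticeBall.2 ((mem_latticeBall.1 hy).trans h)

theorem sum_latticeBall_sdiff {d : ℕ} (g : ℕ → ℝ) {m n : ℕ} (hmn : m ≤ n) :
    ∑ y ∈ latticeBall d n \ latticeBall d m, g (sqNorm y) =
      ∑ k ∈ Finset.Ico m n,
        (((latticeBall d (k + 1)).card : ℝ) - (latticeBall d k).card) * g (k + 1) := by
  induction n, hmn using Nat.le_induction with
  | base => simp
  | succ n hmn ih =>
    rw [Finset.sum_Ico_succ_top hmn, ← ih, ← Finset.sum_sdiff
      (Finset.sdiff_subset_sdiff (latticeBall_mono n.le_succ) (Finset.Subset.refl _))]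
    have hset : (latticeBall d (n + 1) \ latticeBall d m) \ (latticeBall d n \ latticeBall d m) =
        latticeBall d (n + 1) \ latticeBall d n := by
      ext y
      simp only [Finset.mem_sdiff, mem_latticeBall]
      omega
    have hconst : ∀ y ∈ latticeBall d (n + 1) \ latticeBall d n, g (sqNorm y) = g (n + 1) := by
      intro y hy
      simp only [Finset.mem_sdiff, mem_latticeBall] at hy
      congr 1
      omega
    rw [hset, Finset.sum_congr rfl hconst, Finset.sum_const, nsmul_eq_mul,
      Finset.cast_card_sdiff (latticeBall_mono n.le_succ), add_comm]

open scoped Pointwise in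
/-- The number of lattice points in a ball of radius `√n` is asymptotic to the volume of
that ball. -/
theorem tendsto_card_latticeBall (d : ℕ) :
    Tendsto (fun n : ℕ => ((latticeBall d n).card : ℝ) * (n : ℝ) ^ (-((d : ℝ) / 2))) atTop
      (𝓝 (volume.real (Metric.ball (0 : EuclideanSpace ℝ (Fin d)) 1))) := by
  set s : Set (Fin d → ℝ) := {x | ∑ i, x i ^ 2 ≤ 1} with hs
  have hpre : @WithLp.ofLp 2 (Fin d → ℝ) ⁻¹' s = Metric.closedBall 0 1 := by
    ext x
    simp [hs, EuclideanSpace.norm_eq]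
  have hpre' : s = (WithLp.linearEquiv 2 ℝ (Fin d → ℝ)).symm.toLinearMap ⁻¹'
      Metric.closedBall 0 1 := by
    rw [← hpre]; rfl
  have hclosed : IsClosed s := isClosed_le (by fun_prop) continuous_const
  have hconv : Convex ℝ s := by
    rw [hpre']
    exact (convex_closedBall _ _).linear_preimage _
  have hbdd : Bornology.IsBounded s := by
    refine (Metric.isBounded_closedBall (x := (0 : Fin d → ℝ)) (r := 1)).subset fun x hx => ?_
    rw [mem_closedBall_zero_iff, pi_norm_le_iff_of_nonneg zero_le_one]
    intro i
    rw [Real.norm_eq_abs, ← sq_le_one_iff_abs_le_one]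
    exact (Finset.single_le_sum (f := fun i => x i ^ 2) (fun _ _ => sq_nonneg _)
      (Finset.mem_univ i)).trans hx
  have hvol : volume.real s = volume.real (Metric.ball (0 : EuclideanSpace ℝ (Fin d)) 1) := by
    rw [measureReal_def, measureReal_def,
      ← (PiLp.volume_preserving_ofLp (Fin d)).measure_preimage
        hclosed.measurableSet.nullMeasurableSet, hpre]
    rw [Measure.addHaar_closedBall _ _ zero_le_one]
    simp
  have hmono : ∀ ⦃x y : ℝ⦄, 0 < x → x ≤ y → x • s ⊆ y • s := by
    intro x y hx hxy z hz
    have hy : 0 < y := hx.trans_le hxy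
    rw [Set.mem_smul_set_iff_inv_smul_mem₀ hx.ne'] at hz
    rw [Set.mem_smul_set_iff_inv_smul_mem₀ hy.ne']
    have hz' : ∑ i, (x⁻¹ • z) i ^ 2 ≤ 1 := hz
    refine (Finset.sum_le_sum fun i _ => ?_).trans hz'
    simp only [Pi.smul_apply, smul_eq_mul, mul_pow]
    gcongr
  have key := tendsto_card_div_pow_atTop_volume' s hbdd hclosed.measurableSet
    (hconv.addHaar_frontier volume) hmono
  rw [← hvol]
  have hsqrt : Tendsto (fun n : ℕ => Real.sqrt n) atTop atTop :=
    Real.tendsto_sqrt_atTop.comp tendsto_natCast_atTop_atTop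
  refine (key.comp hsqrt).congr' ?_
  filter_upwards [eventually_gt_atTop 0] with n hn
  have hn0 : (0 : ℝ) < n := by exact_mod_cast hn
  have hr : 0 < Real.sqrt n := Real.sqrt_pos.2 hn0
  have hcard : s ∩ (Real.sqrt n)⁻¹ •
      (Submodule.span ℤ (Set.range (Pi.basisFun ℝ (Fin d))) : Set (Fin d → ℝ)) =
      (fun y : Fin d → ℤ => fun i => (Real.sqrt n)⁻¹ * (y i : ℝ)) '' (latticeBall d n) := by
    ext x
    simp only [Set.mem_inter_iff, Set.mem_image, mem_latticeBall,
      Set.mem_inv_smul_set_iff₀ hr.ne', SetLike.mem_coe, Module.Basis.mem_span_iff_repr_mem,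
      Pi.basisFun_repr]
    have hsum : ∀ y : Fin d → ℤ, (∑ i, ((Real.sqrt n)⁻¹ * (y i : ℝ)) ^ 2 ≤ 1) ↔ sqNorm y ≤ n := by
      intro y
      simp only [mul_pow, ← Finset.mul_sum, ← cast_sqNorm, inv_pow, Real.sq_sqrt hn0.le]
      rw [inv_mul_le_iff₀ hn0, mul_one, Nat.cast_le]
    constructor
    · rintro ⟨hx, hL⟩
      choose y hy using hL
      have hxy : (fun i => (Real.sqrt n)⁻¹ * (y i : ℝ)) = x := by
        ext i
        have := hy i
        simp only [algebraMap_int_eq, eq_intCast, Pi.smul_apply, smul_eq_mul] at this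
        rw [this]
        field_simp
      refine ⟨y, (hsum y).1 ?_, hxy⟩
      rw [← hxy] at hx
      exact hx
    · rintro ⟨y, hy, rfl⟩
      refine ⟨(hsum y).2 hy, fun i => ⟨y i, ?_⟩⟩
      simp
      field_simp
  have hinj : Function.Injective
      (fun y : Fin d → ℤ => fun i => (Real.sqrt n)⁻¹ * (y i : ℝ)) := by
    intro y z hyz
    ext i
    have := congrFun hyz i
    simpa [hr.ne'] using this
  have hpow : (n : ℝ) ^ (-((d : ℝ) / 2)) = (Real.sqrt n ^ d)⁻¹ := by
    rw [Real.rpow_neg hn0.le, Real.sqrt_eq_rpow, ← Real.rpow_natCast, ← Real.rpow_mul hn0.le]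
    congr 2
    ring
  simp only [Function.comp, Fintype.card_fin]
  rw [Nat.card_coe_set_eq, hcard, Set.ncard_image_of_injective _ hinj, Set.ncard_coe_finset, hpow,
    div_eq_mul_inv]

/-- Growth of the truncated sums `∑ ‖y‖ ^ (-d)`. -/
theorem tendsto_sum_latticeBall_div_log (d : ℕ) :
    Tendsto (fun n : ℕ => (∑ y ∈ latticeBall d n \ latticeBall d 0,
        (sqNorm y : ℝ) ^ (-((d : ℝ) / 2))) / Real.log n) atTop
      (𝓝 ((d : ℝ) / 2 * volume.real (Metric.ball (0 : EuclideanSpace ℝ (Fin d)) 1))) := by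
  refine (tendsto_sum_sub_mul_rpow_div_log (tendsto_card_latticeBall d)).congr fun n => ?_
  rw [sum_latticeBall_sdiff (fun k => (k : ℝ) ^ (-((d : ℝ) / 2))) (Nat.zero_le n)]
  simp

/-- Decay of the tails of the series `∑ ‖y‖ ^ (-(d + 2))`. -/
theorem exists_forall_sum_sqNorm_rpow_le (d : ℕ) :
    ∃ C : ℝ, ∀ m : ℕ, 1 ≤ m → ∀ F : Finset (Fin d → ℤ), Disjoint F (latticeBall d m) →
      ∑ y ∈ F, (sqNorm y : ℝ) ^ (-((d : ℝ) / 2 + 1)) ≤ C / m := by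
  obtain ⟨C, hC⟩ := (tendsto_card_latticeBall d).bddAbove_range
  have hA : ∀ n : ℕ, 1 ≤ n → ((latticeBall d n).card : ℝ) ≤ C * (n : ℝ) ^ ((d : ℝ) / 2) := by
    intro n hn
    have hn0 : (0 : ℝ) < n := by exact_mod_cast hn
    have := hC ⟨n, rfl⟩
    simp only [Real.rpow_neg hn0.le] at this
    rwa [mul_inv_le_iff₀ (by positivity)] at this
  refine ⟨C * ((d : ℝ) / 2 + 2), fun m hm F hF => ?_⟩
  set n := max m (F.sup sqNorm) with hn
  have hsub : F ⊆ latticeBall d n \ latticeBall d m := fun y hy =>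
    Finset.mem_sdiff.2 ⟨mem_latticeBall.2 ((Finset.le_sup hy).trans (le_max_right _ _)),
      Finset.disjoint_left.1 hF hy⟩
  refine (Finset.sum_le_sum_of_subset_of_nonneg hsub fun _ _ _ => by positivity).trans ?_
  rw [sum_latticeBall_sdiff (fun k => (k : ℝ) ^ (-((d : ℝ) / 2 + 1))) (le_max_left _ _)]
  simpa using sum_Ico_sub_mul_rpow_le (by positivity) (fun n => Nat.cast_nonneg _) hA hm
    (le_max_left m (F.sup sqNorm))

open scoped Pointwise in
/-- The surface measure on the unit sphere is invariant under linear isometries. -/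
theorem integral_toSphere_comp {d : ℕ}
    (L : EuclideanSpace ℝ (Fin d) ≃ₗᵢ[ℝ] EuclideanSpace ℝ (Fin d))
    (g : EuclideanSpace ℝ (Fin d) → ℝ) :
    ∫ v : Metric.sphere (0 : EuclideanSpace ℝ (Fin d)) 1, g (L v)
        ∂((volume : Measure (EuclideanSpace ℝ (Fin d))).toSphere) =
      ∫ v : Metric.sphere (0 : EuclideanSpace ℝ (Fin d)) 1, g v
        ∂((volume : Measure (EuclideanSpace ℝ (Fin d))).toSphere) := by
  let T : Metric.sphere (0 : EuclideanSpace ℝ (Fin d)) 1 ≃ₜ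
      Metric.sphere (0 : EuclideanSpace ℝ (Fin d)) 1 :=
    L.toHomeomorph.subtype fun x => by simp
  have hT : ∀ v, (T v : EuclideanSpace ℝ (Fin d)) = L v := fun v => rfl
  have hmp : MeasurePreserving T (volume : Measure (EuclideanSpace ℝ (Fin d))).toSphere
      (volume : Measure (EuclideanSpace ℝ (Fin d))).toSphere := by
    refine ⟨T.continuous.measurable, ?_⟩
    ext s hs
    rw [Measure.map_apply T.continuous.measurable hs, Measure.toSphere_apply' _ hs,
      Measure.toSphere_apply' _ (T.continuous.measurable hs),
      ← L.measurePreserving.measure_preimage_emb L.toHomeomorph.measurableEmbedding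
        (Set.Ioo (0 : ℝ) 1 • (Subtype.val '' s))]
    congr 2
    ext z
    simp only [Set.mem_smul, Set.mem_image, Set.mem_preimage]
    constructor
    · rintro ⟨r, hr, _, ⟨v, hv, rfl⟩, rfl⟩
      exact ⟨r, hr, _, ⟨T v, hv, rfl⟩, by simp [hT]⟩
    · rintro ⟨r, hr, _, ⟨v, hv, rfl⟩, hz⟩
      refine ⟨r, hr, _, ⟨T.symm v, by simpa using hv, rfl⟩, L.injective ?_⟩
      rw [← hz, map_smul, ← hT, T.apply_symm_apply]
  exact hmp.integral_comp T.measurableEmbedding (fun v => g v)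

theorem Kconst_eq (d : ℕ) (i j : Fin d) :
    Kconst d i j = if i = j then
      (1 / 2 : ℝ) * volume.real (Metric.ball (0 : EuclideanSpace ℝ (Fin d)) 1) else 0 := by
  split_ifs with hij
  · subst hij
    rw [Kconst]
    congr 1
    have hd : (d : ℝ) ≠ 0 := by
      have := i.pos
      positivity
    have hsame : ∀ k : Fin d, ∫ v : Metric.sphere (0 : EuclideanSpace ℝ (Fin d)) 1,
        ((v : EuclideanSpace ℝ (Fin d)) k * (v : EuclideanSpace ℝ (Fin d)) k)
          ∂((volume : Measure (EuclideanSpace ℝ (Fin d))).toSphere) =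
        ∫ v : Metric.sphere (0 : EuclideanSpace ℝ (Fin d)) 1,
        ((v : EuclideanSpace ℝ (Fin d)) i * (v : EuclideanSpace ℝ (Fin d)) i)
          ∂((volume : Measure (EuclideanSpace ℝ (Fin d))).toSphere) := by
      intro k
      rw [← integral_toSphere_comp (LinearIsometryEquiv.piLpCongrLeft 2 ℝ ℝ (Equiv.swap i k))
        (fun v => v i * v i)]
      simp [LinearIsometryEquiv.piLpCongrLeft_apply, Equiv.piCongrLeft']
    have hsum : ∑ k : Fin d, ∫ v : Metric.sphere (0 : EuclideanSpace ℝ (Fin d)) 1,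
        ((v : EuclideanSpace ℝ (Fin d)) k * (v : EuclideanSpace ℝ (Fin d)) k)
          ∂((volume : Measure (EuclideanSpace ℝ (Fin d))).toSphere) =
        d * volume.real (Metric.ball (0 : EuclideanSpace ℝ (Fin d)) 1) := by
      rw [← integral_finsetSum]
      · have h1 : ∀ v : Metric.sphere (0 : EuclideanSpace ℝ (Fin d)) 1,
            ∑ k, ((v : EuclideanSpace ℝ (Fin d)) k * (v : EuclideanSpace ℝ (Fin d)) k) = 1 := by
          intro v
          have := EuclideanSpace.real_norm_sq_eq (v : EuclideanSpace ℝ (Fin d))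
          rw [norm_eq_of_mem_sphere] at this
          simp only [← sq, ← this, one_pow]
        simp [h1, Measure.toSphere_real_apply_univ]
      · intro k _
        exact Continuous.integrable_of_hasCompactSupport (by fun_prop)
          (HasCompactSupport.of_compactSpace _)
    rw [Finset.sum_congr rfl fun k _ => hsame k, Finset.sum_const, Finset.card_univ,
      Fintype.card_fin, nsmul_eq_mul] at hsum
    exact mul_left_cancel₀ hd hsum
  · have h := integral_toSphere_comp (LinearIsometryEquiv.piLpCongrRight 2 fun k : Fin d =>
      if k = i then LinearIsometryEquiv.neg ℝ (E := ℝ) else LinearIsometryEquiv.refl ℝ ℝ)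
        (fun v => v i * v j)
    have hji : j ≠ i := fun h => hij h.symm
    simp only [LinearIsometryEquiv.piLpCongrRight_apply, if_true, if_neg hji,
      LinearIsometryEquiv.coe_neg, LinearIsometryEquiv.coe_refl, id, neg_mul] at h
    rw [integral_neg] at h
    rw [Kconst, self_eq_neg.1 h.symm, mul_zero]

/-- The second order Taylor formula with Peano remainder. -/
theorem exists_taylor_two_le {E : Type*} [NormedAddCommGroup E] [NormedSpace ℝ E] {f : E → ℝ}
    (hf : ContDiff ℝ 2 f) (u : E) {ε : ℝ} (hε : 0 < ε) :
    ∃ δ > 0, ∀ z : E, ‖z‖ ≤ δ →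
      |f (u + z) - f u - fderiv ℝ f u z - 1 / 2 * fderiv ℝ (fderiv ℝ f) u z z| ≤
        ε * ‖z‖ ^ 2 := by
  have hf1 : Differentiable ℝ f := hf.differentiable two_ne_zero
  have hf2 : Differentiable ℝ (fderiv ℝ f) :=
    (hf.fderiv_right (m := 1) (by norm_num)).differentiable one_ne_zero
  have hsymm : IsSymmSndFDerivAt ℝ f u := hf.contDiffAt.isSymmSndFDerivAt (by simp)
  set B := fderiv ℝ (fderiv ℝ f) u with hB
  have hlo := (hasFDerivAt_iff_isLittleO_nhds_zero.1 (hf2 u).hasFDerivAt).def hε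
  obtain ⟨δ, hδ, hball⟩ := Metric.eventually_nhds_iff_ball.1 hlo
  refine ⟨δ / 2, half_pos hδ, fun z hz => ?_⟩
  set φ : E → ℝ := fun z => f (u + z) - f u - fderiv ℝ f u z - 1 / 2 * B z z with hφ
  have hderiv : ∀ x, HasFDerivAt φ (fderiv ℝ f (u + x) - fderiv ℝ f u - B x) x := by
    intro x
    have h1 : HasFDerivAt (fun z => f (u + z)) (fderiv ℝ f (u + x)) x :=
      (hasFDerivAt_comp_add_left u).2 (hf1 (u + x)).hasFDerivAt
    have h2 : HasFDerivAt (fun z => B z z) (B.precompR E x (ContinuousLinearMap.id ℝ E) +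
        B.precompL E (ContinuousLinearMap.id ℝ E) x) x :=
      B.hasFDerivAt_of_bilinear (hasFDerivAt_id x) (hasFDerivAt_id x)
    have h3 := ((h1.sub_const (f u)).sub (fderiv ℝ f u).hasFDerivAt).sub (h2.const_mul (1 / 2))
    refine h3.congr_fderiv ?_
    ext w
    have := hsymm x w
    simp only [← hB] at this
    simp [this]
    ring
  have hbound : ∀ x ∈ Metric.closedBall (0 : E) ‖z‖,
      ‖fderiv ℝ f (u + x) - fderiv ℝ f u - B x‖ ≤ ε * ‖z‖ := by
    intro x hx
    rw [mem_closedBall_zero_iff] at hx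
    refine (hball x (mem_ball_zero_iff.2 (by linarith))).trans ?_
    gcongr
  have := (convex_closedBall (0 : E) ‖z‖).norm_image_sub_le_of_norm_hasFDerivWithin_le
    (fun x _ => (hderiv x).hasFDerivWithinAt) hbound
    (Metric.mem_closedBall_self (norm_nonneg z)) (mem_closedBall_zero_iff.2 le_rfl)
  simpa [hφ, sq, mul_assoc] using this

theorem sum_latticeBall_comp_equiv {d : ℕ} (e : (Fin d → ℤ) ≃ (Fin d → ℤ))
    (he : ∀ y, sqNorm (e y) = sqNorm y) (m n : ℕ) (F : (Fin d → ℤ) → ℝ) :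
    ∑ y ∈ latticeBall d n \ latticeBall d m, F (e y) =
      ∑ y ∈ latticeBall d n \ latticeBall d m, F y :=
  Finset.sum_equiv e (fun y => by simp [mem_latticeBall, he]) fun _ _ => rfl

/-- The weight `‖y‖ ^ (-(d + 2))` of a lattice point. -/
noncomputable def latticeWeight {d : ℕ} (y : Fin d → ℤ) : ℝ :=
  (sqNorm y : ℝ) ^ (-((d : ℝ) / 2 + 1))

theorem latticeWeight_nonneg {d : ℕ} (y : Fin d → ℤ) : 0 ≤ latticeWeight y := by
  unfold latticeWeight; positivity

theorem sum_latticeWeight_mul_linear_eq_zero {d : ℕ} (m n : ℕ) (l : (Fin d → ℝ) →L[ℝ] ℝ) :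
    ∑ y ∈ latticeBall d n \ latticeBall d m, latticeWeight y * l (fun i => (y i : ℝ)) = 0 := by
  have hs : ∀ y : Fin d → ℤ, sqNorm (-y) = sqNorm y := fun y => by simp [sqNorm]
  have h := sum_latticeBall_comp_equiv (Equiv.neg (Fin d → ℤ)) hs m n
    (fun y => latticeWeight y * l (fun i => (y i : ℝ)))
  have hl : ∀ y : Fin d → ℤ, l (fun i => (((-y) i : ℤ) : ℝ)) = -l (fun i => (y i : ℝ)) := by
    intro y
    rw [← map_neg]
    congr 1
    ext i
    simp
  simp only [Equiv.neg_apply, latticeWeight, hs, hl, mul_neg, Finset.sum_neg_distrib] at h ⊢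
  linarith

theorem sum_latticeWeight_mul_coord {d : ℕ} (n : ℕ) (i j : Fin d) :
    ∑ y ∈ latticeBall d n \ latticeBall d 0, latticeWeight y * ((y i : ℝ) * (y j : ℝ)) =
      if i = j then (∑ y ∈ latticeBall d n \ latticeBall d 0,
        (sqNorm y : ℝ) ^ (-((d : ℝ) / 2))) / d else 0 := by
  split_ifs with hij
  · subst hij
    have hd : (d : ℝ) ≠ 0 := by
      have := i.pos
      positivity
    have hsame : ∀ k : Fin d,
        ∑ y ∈ latticeBall d n \ latticeBall d 0, latticeWeight y * ((y k : ℝ) * (y k : ℝ)) =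
        ∑ y ∈ latticeBall d n \ latticeBall d 0, latticeWeight y * ((y i : ℝ) * (y i : ℝ)) := by
      intro k
      have hs : ∀ y : Fin d → ℤ,
          sqNorm ((Equiv.swap i k).arrowCongr (Equiv.refl ℤ) y) = sqNorm y := fun y =>
        Equiv.sum_comp (Equiv.swap i k).symm fun l => (y l).natAbs ^ 2
      rw [← sum_latticeBall_comp_equiv _ hs 0 n
        (fun y => latticeWeight y * ((y i : ℝ) * (y i : ℝ)))]
      simp only [latticeWeight, hs]
      simp [Equiv.arrowCongr]
    have hsum : ∑ k : Fin d, ∑ y ∈ latticeBall d n \ latticeBall d 0,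
        latticeWeight y * ((y k : ℝ) * (y k : ℝ)) =
        ∑ y ∈ latticeBall d n \ latticeBall d 0, (sqNorm y : ℝ) ^ (-((d : ℝ) / 2)) := by
      rw [Finset.sum_comm]
      refine Finset.sum_congr rfl fun y hy => ?_
      have hy0 : (0 : ℝ) < sqNorm y := by
        simp only [Finset.mem_sdiff, mem_latticeBall] at hy
        exact_mod_cast by omega
      simp only [← Finset.mul_sum, ← sq, ← cast_sqNorm]
      rw [latticeWeight, ← Real.rpow_add_one hy0.ne']
      congr 1
      ring
    rw [Finset.sum_congr rfl fun k _ => hsame k, Finset.sum_const, Finset.card_univ,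
      Fintype.card_fin, nsmul_eq_mul] at hsum
    rw [← hsum]
    field_simp
  · have hji : j ≠ i := fun h => hij h.symm
    let e : (Fin d → ℤ) ≃ (Fin d → ℤ) :=
      Equiv.piCongrRight fun k => if k = i then Equiv.neg ℤ else Equiv.refl ℤ
    have hi : ∀ y, e y i = -y i := fun y => by simp [e]
    have hne : ∀ y k, k ≠ i → e y k = y k := fun y k hk => by simp [e, hk]
    have hs : ∀ y, sqNorm (e y) = sqNorm y := by
      refine fun y => Finset.sum_congr rfl fun k _ => ?_
      by_cases hk : k = i
      · rw [hk, hi, Int.natAbs_neg]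
      · rw [hne y k hk]
    have h := sum_latticeBall_comp_equiv e hs 0 n
      (fun y => latticeWeight y * ((y i : ℝ) * (y j : ℝ)))
    simp only [latticeWeight, hs, hi, hne _ j hji, Int.cast_neg, neg_mul, mul_neg,
      Finset.sum_neg_distrib] at h ⊢
    linarith

theorem sum_latticeWeight_mul_bilinear {d : ℕ} (n : ℕ)
    (B : (Fin d → ℝ) →L[ℝ] (Fin d → ℝ) →L[ℝ] ℝ) :
    ∑ y ∈ latticeBall d n \ latticeBall d 0,
        latticeWeight y * B (fun i => (y i : ℝ)) (fun i => (y i : ℝ)) =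
      (∑ i, B (Pi.single i 1) (Pi.single i 1)) / d *
        ∑ y ∈ latticeBall d n \ latticeBall d 0, (sqNorm y : ℝ) ^ (-((d : ℝ) / 2)) := by
  have hB : ∀ x : Fin d → ℝ, B x x = ∑ i, ∑ j, x i * x j * B (Pi.single i 1) (Pi.single j 1) := by
    intro x
    have hx : x = ∑ i, x i • (Pi.single i 1 : Fin d → ℝ) := by
      ext j
      simp [Finset.sum_apply, Pi.single_apply]
    conv_lhs => rw [hx]
    simp only [map_sum, map_smul, sum_apply, smul_apply,
      smul_eq_mul, Finset.mul_sum]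
    rw [Finset.sum_comm]
    exact Finset.sum_congr rfl fun i _ => Finset.sum_congr rfl fun j _ => by ring
  calc _ = ∑ i, ∑ j, B (Pi.single i 1) (Pi.single j 1) *
        ∑ y ∈ latticeBall d n \ latticeBall d 0, latticeWeight y * ((y i : ℝ) * (y j : ℝ)) := by
        simp only [hB, Finset.mul_sum]
        rw [Finset.sum_comm]
        refine Finset.sum_congr rfl fun i _ => ?_
        rw [Finset.sum_comm]
        exact Finset.sum_congr rfl fun j _ => Finset.sum_congr rfl fun y _ => by ring
    _ = _ := by
        simp only [sum_latticeWeight_mul_coord, mul_ite, mul_zero, Finset.sum_ite_eq,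
          Finset.mem_univ, if_true, ← Finset.sum_mul]
        ring

theorem summable_latticeWeight (d : ℕ) : Summable (latticeWeight (d := d)) := by
  obtain ⟨C, hC⟩ := exists_forall_sum_sqNorm_rpow_le d
  refine summable_of_sum_le (c := ∑ y ∈ latticeBall d 1, latticeWeight y + C / (1 : ℕ))
    (fun y => latticeWeight_nonneg y) fun F => ?_
  rw [← Finset.sum_inter_add_sum_sdiff F (latticeBall d 1)]
  exact add_le_add (Finset.sum_le_sum_of_subset_of_nonneg Finset.inter_subset_right
    fun y _ _ => latticeWeight_nonneg y) (hC 1 le_rfl _ Finset.sdiff_disjoint)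

theorem abs_tsum_sub_sum_latticeBall_le {d : ℕ} {C K : ℝ} {m : ℕ} (hK : 0 ≤ K)
    (hC : ∀ F : Finset (Fin d → ℤ), Disjoint F (latticeBall d m) →
      ∑ y ∈ F, latticeWeight y ≤ C) {g : (Fin d → ℤ) → ℝ} (hg : ∀ y, |g y| ≤ K) :
    |∑' y, latticeWeight y * g y - ∑ y ∈ latticeBall d m, latticeWeight y * g y| ≤ K * C := by
  have hle : ∀ y, |latticeWeight y * g y| ≤ K * latticeWeight y := fun y => by
    rw [abs_mul, abs_of_nonneg (latticeWeight_nonneg y), mul_comm K]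
    exact mul_le_mul_of_nonneg_left (hg y) (latticeWeight_nonneg y)
  have hsum : Summable fun y => latticeWeight y * g y :=
    ((summable_latticeWeight d).mul_left K).of_norm_bounded hle
  refine le_of_tendsto (hsum.hasSum.sub_const _).abs ?_
  filter_upwards [eventually_ge_atTop (latticeBall d m)] with F hF
  rw [← Finset.sum_sdiff hF, add_sub_cancel_right]
  calc _ ≤ ∑ y ∈ F \ latticeBall d m, K * latticeWeight y :=
        (Finset.abs_sum_le_sum_abs _ _).trans (Finset.sum_le_sum fun y _ => hle y)
    _ ≤ K * C := by
        rw [← Finset.mul_sum]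
        exact mul_le_mul_of_nonneg_left (hC _ Finset.sdiff_disjoint) hK

theorem inv_zl2_rpow {d : ℕ} (y : Fin d → ℤ) : (zl2 y ^ ((d : ℝ) + 2))⁻¹ = latticeWeight y := by
  have h0 : (0 : ℝ) ≤ sqNorm y := Nat.cast_nonneg _
  rw [latticeWeight, zl2, l2norm, ← cast_sqNorm, Real.sqrt_eq_rpow, ← Real.rpow_mul h0,
    Real.rpow_neg h0]
  congr 2
  ring

/-- Quantitative comparison of the rescaled nonlocal operator with the Laplacian. -/
theorem abs_tsum_sub_laplacian_le {d : ℕ} {f : (Fin d → ℝ) → ℝ} {u : Fin d → ℝ} {K C ε δ : ℝ}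
    (hK : ∀ x, |f x| ≤ K)
    (hC : ∀ m : ℕ, 1 ≤ m → ∀ F : Finset (Fin d → ℤ), Disjoint F (latticeBall d m) →
      ∑ y ∈ F, latticeWeight y ≤ C / m) (hδ : 0 ≤ δ)
    (htaylor : ∀ z, ‖z‖ ≤ δ → |f (u + z) - f u - fderiv ℝ f u z -
      1 / 2 * fderiv ℝ (fderiv ℝ f) u z z| ≤ ε * ‖z‖ ^ 2) (hε : 0 ≤ ε)
    {r : ℝ} (hr : 0 < r) {m : ℕ} (hm : 1 ≤ m) (hmr : (m : ℝ) ≤ δ ^ 2 * r ^ 2) :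
    |∑' y : {y : Fin d → ℤ // y ≠ 0},
        (f (u + fun i => (y.1 i : ℝ) / r) - f u) / zl2 y.1 ^ ((d : ℝ) + 2) -
      (∑ i, fderiv ℝ (fderiv ℝ f) u (Pi.single i 1) (Pi.single i 1)) / (2 * d) / r ^ 2 *
        ∑ y ∈ latticeBall d m \ latticeBall d 0, (sqNorm y : ℝ) ^ (-((d : ℝ) / 2))| ≤
      ε / r ^ 2 * (∑ y ∈ latticeBall d m \ latticeBall d 0, (sqNorm y : ℝ) ^ (-((d : ℝ) / 2))) +
        2 * K * (C / m) := by
  set B := fderiv ℝ (fderiv ℝ f) u with hB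
  set g : (Fin d → ℤ) → ℝ := fun y => f (u + fun i => (y i : ℝ) / r) - f u with hg
  have hg0 : g 0 = 0 := by
    have : (fun i : Fin d => (((0 : Fin d → ℤ) i : ℤ) : ℝ) / r) = 0 := by ext; simp
    simp only [hg, this, add_zero, sub_self]
  have hgK : ∀ y, |g y| ≤ 2 * K := fun y =>
    (abs_sub _ _).trans (by linarith [hK (u + fun i => (y i : ℝ) / r), hK u])
  have htsum : ∑' y : {y : Fin d → ℤ // y ≠ 0},
      (f (u + fun i => (y.1 i : ℝ) / r) - f u) / zl2 y.1 ^ ((d : ℝ) + 2) =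
      ∑' y, latticeWeight y * g y := by
    rw [← tsum_subtype_eq_of_support_subset (s := {y : Fin d → ℤ | y ≠ 0})]
    · refine tsum_congr fun y => ?_
      rw [div_eq_mul_inv, inv_zl2_rpow, mul_comm]
    · intro y hy hy0
      simp [hy0, hg0] at hy
  have htail := abs_tsum_sub_sum_latticeBall_le (m := m) (K := 2 * K)
    (by linarith [(abs_nonneg _).trans (hK 0)]) (hC m hm) hgK
  have hball : ∑ y ∈ latticeBall d m, latticeWeight y * g y =
      ∑ y ∈ latticeBall d m \ latticeBall d 0, latticeWeight y * g y := by
    refine (Finset.sum_subset Finset.sdiff_subset fun y hy hy' => ?_).symm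
    simp only [Finset.mem_sdiff, hy, true_and, not_not, mem_latticeBall, Nat.le_zero,
      sqNorm_eq_zero] at hy'
    rw [hy', hg0, mul_zero]
  have hz : ∀ y : Fin d → ℤ, (fun i => (y i : ℝ) / r) = r⁻¹ • fun i => (y i : ℝ) := by
    intro y
    ext i
    simp [div_eq_inv_mul]
  have hnorm : ∀ y : Fin d → ℤ, ‖fun i => (y i : ℝ) / r‖ ^ 2 ≤ sqNorm y / r ^ 2 := by
    intro y
    have h0 : (0 : ℝ) ≤ sqNorm y := Nat.cast_nonneg _
    have : ‖fun i => (y i : ℝ) / r‖ ≤ Real.sqrt (sqNorm y) / r := by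
      rw [pi_norm_le_iff_of_nonneg (by positivity)]
      intro i
      rw [Real.norm_eq_abs, abs_div, abs_of_pos hr]
      gcongr
      refine Real.abs_le_sqrt ?_
      rw [cast_sqNorm]
      exact Finset.single_le_sum (f := fun i => (y i : ℝ) ^ 2) (fun _ _ => sq_nonneg _)
        (Finset.mem_univ i)
    calc _ ≤ (Real.sqrt (sqNorm y) / r) ^ 2 := by gcongr
      _ = _ := by rw [div_pow, Real.sq_sqrt h0]
  set R : (Fin d → ℤ) → ℝ := fun y => g y - fderiv ℝ f u (fun i => (y i : ℝ) / r) -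
      1 / 2 * B (fun i => (y i : ℝ) / r) (fun i => (y i : ℝ) / r) with hR
  have hmain : ∑ y ∈ latticeBall d m \ latticeBall d 0, latticeWeight y * g y =
      (∑ i, B (Pi.single i 1) (Pi.single i 1)) / (2 * d) / r ^ 2 *
        (∑ y ∈ latticeBall d m \ latticeBall d 0, (sqNorm y : ℝ) ^ (-((d : ℝ) / 2))) +
      ∑ y ∈ latticeBall d m \ latticeBall d 0, latticeWeight y * R y := by
    have hexp : ∀ y, latticeWeight y * g y =
        r⁻¹ * (latticeWeight y * fderiv ℝ f u (fun i => (y i : ℝ))) +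
        1 / 2 / r ^ 2 * (latticeWeight y * B (fun i => (y i : ℝ)) (fun i => (y i : ℝ))) +
        latticeWeight y * R y := by
      intro y
      simp only [hR, hz, map_smul, smul_apply, smul_eq_mul]
      field_simp
      ring
    rw [Finset.sum_congr rfl fun y _ => hexp y, Finset.sum_add_distrib, Finset.sum_add_distrib,
      ← Finset.mul_sum, ← Finset.mul_sum, sum_latticeWeight_mul_linear_eq_zero,
      sum_latticeWeight_mul_bilinear]
    ring
  have hrem : |∑ y ∈ latticeBall d m \ latticeBall d 0, latticeWeight y * R y| ≤
      ε / r ^ 2 *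
        ∑ y ∈ latticeBall d m \ latticeBall d 0, (sqNorm y : ℝ) ^ (-((d : ℝ) / 2)) := by
    rw [Finset.mul_sum]
    refine (Finset.abs_sum_le_sum_abs _ _).trans (Finset.sum_le_sum fun y hy => ?_)
    simp only [Finset.mem_sdiff, mem_latticeBall] at hy
    have hy0 : (0 : ℝ) < sqNorm y := by exact_mod_cast by omega
    have hym : (sqNorm y : ℝ) ≤ m := by exact_mod_cast hy.1
    have hsmall : ‖fun i => (y i : ℝ) / r‖ ≤ δ := by
      refine le_of_sq_le_sq ((hnorm y).trans ?_) hδ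
      rw [div_le_iff₀ (by positivity)]
      exact hym.trans hmr
    have hRy : |R y| ≤ ε * (sqNorm y / r ^ 2) :=
      (htaylor _ hsmall).trans (mul_le_mul_of_nonneg_left (hnorm y) hε)
    have hw : (sqNorm y : ℝ) ^ (-((d : ℝ) / 2)) = latticeWeight y * sqNorm y := by
      rw [latticeWeight, ← Real.rpow_add_one hy0.ne']
      congr 1
      ring
    rw [abs_mul, abs_of_nonneg (latticeWeight_nonneg y), hw]
    calc _ ≤ latticeWeight y * (ε * (sqNorm y / r ^ 2)) :=
          mul_le_mul_of_nonneg_left hRy (latticeWeight_nonneg y)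
      _ = _ := by ring
  rw [htsum]
  rw [hball, hmain] at htail
  rw [abs_le] at htail hrem ⊢
  constructor <;> linarith [htail.1, htail.2, hrem.1, hrem.2]

theorem tendsto_log_floor_div_log {c : ℝ} (hc : 0 < c) :
    Tendsto (fun N : ℝ => Real.log ⌊c * (N * Real.log N)⌋₊ / Real.log N) atTop (𝓝 1) := by
  have hNlog : Tendsto (fun N : ℝ => c * (N * Real.log N)) atTop atTop :=
    (tendsto_id.atTop_mul_atTop₀ Real.tendsto_log_atTop).const_mul_atTop hc
  have h1 : Tendsto (fun N : ℝ => Real.log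
      ((⌊c * (N * Real.log N)⌋₊ : ℝ) / (c * (N * Real.log N)))) atTop (𝓝 0) := by
    have := (tendsto_nat_floor_div_atTop (R := ℝ)).comp hNlog
    simpa [Function.comp_def] using this.log one_ne_zero
  have h2 : Tendsto (fun N : ℝ => Real.log (Real.log N) / Real.log N) atTop (𝓝 0) :=
    (Real.isLittleO_log_id_atTop.comp_tendsto Real.tendsto_log_atTop).tendsto_div_nhds_zero
  have h3 := (((h1.add_const (Real.log c)).div_atTop Real.tendsto_log_atTop).add h2).add_const 1
  rw [zero_add, zero_add] at h3
  refine h3.congr' ?_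
  filter_upwards [eventually_gt_atTop 0, Real.tendsto_log_atTop.eventually_gt_atTop 0,
    hNlog.eventually_ge_atTop 1] with N hN hl h1
  have hfl : (0 : ℝ) < ⌊c * (N * Real.log N)⌋₊ := by exact_mod_cast Nat.floor_pos.2 h1
  rw [Real.log_div hfl.ne' (by positivity), Real.log_mul hc.ne' (by positivity),
    Real.log_mul hN.ne' hl.ne']
  field_simp
  ring

theorem tendsto_div_floor_mul_log {c : ℝ} (hc : 0 < c) :
    Tendsto (fun N : ℝ => N / (⌊c * (N * Real.log N)⌋₊ : ℝ)) atTop (𝓝 0) := by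
  have hNlog : Tendsto (fun N : ℝ => c * (N * Real.log N)) atTop atTop :=
    (tendsto_id.atTop_mul_atTop₀ Real.tendsto_log_atTop).const_mul_atTop hc
  have h1 := ((tendsto_nat_floor_div_atTop (R := ℝ)).comp hNlog).inv₀ one_ne_zero
  have h2 := (Real.tendsto_log_atTop.const_mul_atTop hc).inv_tendsto_atTop.mul h1
  rw [zero_mul] at h2
  refine h2.congr' ?_
  filter_upwards [eventually_gt_atTop 0, Real.tendsto_log_atTop.eventually_gt_atTop 0,
    hNlog.eventually_ge_atTop 1] with N hN hl h1
  have hfl : (0 : ℝ) < ⌊c * (N * Real.log N)⌋₊ := by exact_mod_cast Nat.floor_pos.2 h1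
  simp only [Pi.inv_apply, Function.comp]
  field_simp

/-- **Generator convergence in the critical case `α = 2`** (from Subsection 1.2): for every
smooth compactly supported `f : R^d → R` and every `u ∈ R^d`,
`lim_{N→∞} N Σ_{y≠0} ‖y‖₂^{−(d+2)} (f(u + y/√(N log N)) − f(u))
  = (1/2) Σ_{i,j} K^{i,j} ∂²f/∂u_i∂u_j(u)`, the limit being over real `N > 1`. -/
theorem generator_convergence_critical (d : ℕ) (hd : 1 ≤ d)
    (f : (Fin d → ℝ) → ℝ) (hf : ContDiff ℝ (⊤ : ℕ∞) f) (hsupp : HasCompactSupport f)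
    (u : Fin d → ℝ) :
    Tendsto
      (fun N : ℝ => N *
        ∑' y : {y : Fin d → ℤ // y ≠ 0},
          (f (u + fun i => (y.1 i : ℝ) / Real.sqrt (N * Real.log N)) - f u) /
            zl2 y.1 ^ ((d : ℝ) + 2))
      atTop
      (𝓝 ((1 / 2 : ℝ) * ∑ i, ∑ j, Kconst d i j *
        fderiv ℝ (fun w => fderiv ℝ f w (Pi.single j 1)) u (Pi.single i 1))) := by
  have hf2 : ContDiff ℝ 2 f := contDiff_infty.1 hf 2
  have hdf : Differentiable ℝ (fderiv ℝ f) :=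
    (hf2.fderiv_right (m := 1) (by norm_num)).differentiable one_ne_zero
  obtain ⟨K, hK⟩ := hsupp.exists_bound_of_continuous hf.continuous
  obtain ⟨C, hC⟩ := exists_forall_sum_sqNorm_rpow_le d
  have hd0 : (d : ℝ) ≠ 0 := by positivity
  set V := volume.real (Metric.ball (0 : EuclideanSpace ℝ (Fin d)) 1) with hV
  have hV0 : 0 ≤ V := measureReal_nonneg
  set Δ : ℝ := ∑ i, fderiv ℝ (fderiv ℝ f) u (Pi.single i 1) (Pi.single i 1) with hΔ
  set L : ℕ → ℝ := fun n => ∑ y ∈ latticeBall d n \ latticeBall d 0,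
    (sqNorm y : ℝ) ^ (-((d : ℝ) / 2)) with hL
  have hsecond : ∀ v w : Fin d → ℝ,
      fderiv ℝ (fun x => fderiv ℝ f x w) u v = fderiv ℝ (fderiv ℝ f) u v w := by
    intro v w
    rw [((hdf u).hasFDerivAt.clm_apply (hasFDerivAt_const w u)).fderiv]
    simp
  have hlimit : (1 / 2 : ℝ) * ∑ i, ∑ j, Kconst d i j *
      fderiv ℝ (fun w => fderiv ℝ f w (Pi.single j 1)) u (Pi.single i 1) =
      Δ / (2 * d) * ((d : ℝ) / 2 * V) := by
    simp only [Kconst_eq, hsecond, ite_mul, zero_mul, Finset.sum_ite_eq, Finset.mem_univ, if_true,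
      ← Finset.mul_sum, ← hΔ, ← hV]
    field_simp
  rw [hlimit, Metric.tendsto_nhds]
  intro η hη
  set ε := η / (2 * (d * V + 1)) with hε
  have hε0 : 0 < ε := by positivity
  obtain ⟨δ, hδ, htaylor⟩ := exists_taylor_two_le hf2 u hε0
  have hδ2 : 0 < δ ^ 2 := by positivity
  set M : ℝ → ℕ := fun N => ⌊δ ^ 2 * (N * Real.log N)⌋₊ with hM
  have hNlog : Tendsto (fun N : ℝ => δ ^ 2 * (N * Real.log N)) atTop atTop :=
    (tendsto_id.atTop_mul_atTop₀ Real.tendsto_log_atTop).const_mul_atTop hδ2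
  have hMtop : Tendsto M atTop atTop := tendsto_nat_floor_atTop.comp hNlog
  have hLlim : Tendsto (fun N => L (M N) / Real.log N) atTop (𝓝 ((d : ℝ) / 2 * V)) := by
    have h := ((tendsto_sum_latticeBall_div_log d).comp hMtop).mul (tendsto_log_floor_div_log hδ2)
    rw [mul_one] at h
    refine h.congr' ?_
    filter_upwards [hMtop.eventually_ge_atTop 2] with N hN
    have : 0 < Real.log (M N) := Real.log_pos (by exact_mod_cast hN)
    change L (M N) / Real.log (M N) * (Real.log (M N) / Real.log N) = _
    field_simp
  have hmain := hLlim.const_mul (Δ / (2 * d))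
  have herr := (hLlim.const_mul ε).add
    ((tendsto_div_floor_mul_log hδ2).const_mul (2 * K * C))
  rw [mul_zero, add_zero] at herr
  have hsmall : ε * ((d : ℝ) / 2 * V) < η / 2 := by
    rw [hε, div_mul_eq_mul_div, div_lt_div_iff₀ (by positivity) two_pos]
    nlinarith [mul_nonneg (Nat.cast_nonneg (α := ℝ) d) hV0]
  filter_upwards [Metric.tendsto_nhds.1 hmain (η / 2) (half_pos hη),
    herr.eventually_lt_const hsmall, hMtop.eventually_ge_atTop 1, eventually_gt_atTop 1]
    with N hN1 hN2 hN3 hN4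
  have hlog : 0 < Real.log N := Real.log_pos hN4
  have hN0 : 0 < N := zero_lt_one.trans hN4
  have hr2 : Real.sqrt (N * Real.log N) ^ 2 = N * Real.log N := Real.sq_sqrt (by positivity)
  have hkey := abs_tsum_sub_laplacian_le (u := u) hK hC hδ.le htaylor hε0.le
    (r := Real.sqrt (N * Real.log N)) (Real.sqrt_pos.2 (by positivity)) hN3
    (by rw [hr2]; exact Nat.floor_le (by positivity))
  rw [hr2] at hkey
  have hkey' := mul_le_mul_of_nonneg_left hkey hN0.le
  rw [← abs_of_pos hN0, ← abs_mul, abs_of_pos hN0, mul_sub, mul_add] at hkey'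
  have hM0 : (0 : ℝ) < M N := by exact_mod_cast hN3
  have e1 : N * (Δ / (2 * d) / (N * Real.log N) * L (M N)) =
      Δ / (2 * d) * (L (M N) / Real.log N) := by
    field_simp
  have e2 : N * (ε / (N * Real.log N) * L (M N)) = ε * (L (M N) / Real.log N) := by
    field_simp
  have e3 : N * (2 * K * (C / M N)) = 2 * K * C * (N / M N) := by ring
  simp only [← hΔ] at hkey'
  rw [e1, e2, e3] at hkey'
  rw [Real.dist_eq] at hN1 ⊢
  rw [abs_lt] at hN1 ⊢
  have h := abs_le.1 (hkey'.trans hN2.le)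
  constructor <;> linarith [h.1, h.2, hN1.1, hN1.2]
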